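/- Let (R,m,K)→(S,n,L) be a flat local homomorphism of F-finite reduced Noetherian local rings of prime characteristic p whose closed fiber S/mS is Gorenstein, and let c ∈ R. If the inclusion R c^{1/q} ⊆ R^{1/q} splits as a map of R-modules for some q, and S/mS is F-injective, then the inclusion S c^{1/q} ⊆ S^{1/q} splits as a map of S-modules for some q (where c also denotes the image of c in S). -/

import Mathlib

open IsLocalRing

/-- The Frobenius power `I^[q]` of an ideal: the ideal generated by the `q`-th powers
of the elements of `I`. -/
def Ideal.frobPow {R : Type*} [CommRing R] (I : Ideal R) (q : ℕ) : Ideal R :=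
  Ideal.span ((fun x : R => x ^ q) '' (I : Set R))

/-- `R°`: the complement in `R` of the union of the minimal primes of `R`. -/
def circComplement (R : Type*) [CommRing R] : Set R :=
  {c : R | ∀ P ∈ minimalPrimes R, c ∉ P}

/-- `x ∈ I*`: tight closure membership (`p` is the characteristic). -/
def MemTightClosure {R : Type*} [CommRing R] (p : ℕ) (I : Ideal R) (x : R) : Prop :=
  ∃ c ∈ circComplement R, ∃ N : ℕ, ∀ e : ℕ, N ≤ e → c * x ^ p ^ e ∈ I.frobPow (p ^ e)

/-- An ideal is tightly closed if `I* = I`. -/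
def Ideal.IsTightlyClosed {R : Type*} [CommRing R] (p : ℕ) (I : Ideal R) : Prop :=
  ∀ x : R, MemTightClosure p I x → x ∈ I

/-- An ideal is Frobenius closed if `x^q ∈ I^[q]` for some `q` implies `x ∈ I`. -/
def Ideal.IsFrobeniusClosed {R : Type*} [CommRing R] (p : ℕ) (I : Ideal R) : Prop :=
  ∀ x : R, (∃ e : ℕ, x ^ p ^ e ∈ I.frobPow (p ^ e)) → x ∈ I

/-- A ring is weakly F-regular if every ideal is tightly closed. -/
def IsWeaklyFRegular (R : Type*) [CommRing R] (p : ℕ) : Prop :=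
  ∀ I : Ideal R, I.IsTightlyClosed p

/-- A test element: an element of `R°` that works in every tight closure test. -/
def IsTestElement {R : Type*} [CommRing R] (p : ℕ) (c : R) : Prop :=
  c ∈ circComplement R ∧
    ∀ (I : Ideal R) (x : R), MemTightClosure p I x → ∀ e : ℕ, c * x ^ p ^ e ∈ I.frobPow (p ^ e)

/-- A (full) system of parameters of a local ring: `dim R` elements of the maximal
ideal generating an ideal whose radical is the maximal ideal. -/
def IsSystemOfParameters (R : Type*) [CommRing R] [IsLocalRing R] {n : ℕ} (x : Fin n → R) : Prop :=
  ringKrullDim R = n ∧ (∀ i, x i ∈ maximalIdeal R) ∧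
    maximalIdeal R ≤ (Ideal.span (Set.range x)).radical

/-- A parameter ideal: an ideal generated by part of a system of parameters. -/
def Ideal.IsParameterIdeal {R : Type*} [CommRing R] [IsLocalRing R] (I : Ideal R) : Prop :=
  ∃ (n k : ℕ) (h : k ≤ n) (x : Fin n → R), IsSystemOfParameters R x ∧
    I = Ideal.span (Set.range fun i : Fin k => x (Fin.castLE h i))

/-- A local ring is F-rational if every parameter ideal is tightly closed. -/
def IsFRational (R : Type*) [CommRing R] [IsLocalRing R] (p : ℕ) : Prop :=
  ∀ I : Ideal R, I.IsParameterIdeal → I.IsTightlyClosed p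

/-- A local ring is F-injective if every parameter ideal is Frobenius closed. -/
def IsFInjective (R : Type*) [CommRing R] [IsLocalRing R] (p : ℕ) : Prop :=
  ∀ I : Ideal R, I.IsParameterIdeal → I.IsFrobeniusClosed p

/-- A local ring is Cohen-Macaulay if some system of parameters is a regular sequence. -/
def IsCohenMacaulayLocalRing (R : Type*) [CommRing R] [IsLocalRing R] : Prop :=
  ∃ (n : ℕ) (x : Fin n → R), IsSystemOfParameters R x ∧
    RingTheory.Sequence.IsRegular R (List.ofFn x)

/-- An irreducible ideal: a proper ideal that is not the intersection of two
strictly larger ideals. -/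
def Ideal.IsIrreducible {R : Type*} [CommRing R] (I : Ideal R) : Prop :=
  I ≠ ⊤ ∧ ∀ A B : Ideal R, I = A ⊓ B → I = A ∨ I = B

/-- A local ring is Gorenstein if it is Cohen-Macaulay and some system of parameters
generates an irreducible ideal. -/
def IsGorensteinLocalRing (R : Type*) [CommRing R] [IsLocalRing R] : Prop :=
  ∃ (n : ℕ) (x : Fin n → R), IsSystemOfParameters R x ∧
    RingTheory.Sequence.IsRegular R (List.ofFn x) ∧
    (Ideal.span (Set.range x)).IsIrreducible

/-- The inclusion `R·c^{1/q} ⊆ R^{1/q}` (with `q = p^e`) splits over `R`: identifying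
`R^{1/q}` with `R` via `x^{1/q} ↦ x`, this says there is an additive map `θ : R → R`
which is `R`-linear for the `q`-th power action and sends `c` to `1`. -/
def FrobSplits {R : Type*} [CommRing R] (p : ℕ) (c : R) (e : ℕ) : Prop :=
  ∃ θ : R →+ R, (∀ a x : R, θ (a ^ p ^ e * x) = a * θ x) ∧ θ c = 1

/-- A reduced ring of characteristic `p` is F-finite if `R^{1/p}` is a finitely
generated `R`-module, i.e. `R` is finitely generated over its subring of `p`-th powers. -/
def IsFFinite (R : Type*) [CommRing R] (p : ℕ) : Prop :=
  ∃ s : Finset R, ∀ x : R, ∃ a : R → R, x = ∑ i ∈ s, a i ^ p * i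

/-- An F-finite reduced ring is strongly F-regular if for every `c ∈ R°` there is a `q`
such that `R·c^{1/q} ⊆ R^{1/q}` splits over `R`. -/
def IsStronglyFRegular (R : Type*) [CommRing R] (p : ℕ) : Prop :=
  ∀ c ∈ circComplement R, ∃ e : ℕ, FrobSplits p c e

section

open TensorProduct

section
variable {R N W : Type*} [CommRing R] [AddCommGroup N] [Module R N] [AddCommGroup W] [Module R W]

/-- Over a flat algebra, an elementary tensor `s ⊗ w` vanishes only if `s` lies in the extension
of the annihilator of `w`. -/
theorem mem_map_ker_of_tmul_eq_zero {S : Type*} [CommRing S] [Algebra R S] [Module.Flat R S]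
    {w : W} {s : S} (h : s ⊗ₜ[R] w = 0) :
    s ∈ Ideal.map (algebraMap R S) (LinearMap.ker (LinearMap.toSpanSingleton R W w)) := by
  set K : Ideal R := LinearMap.ker (LinearMap.toSpanSingleton R W w) with hK
  have hex : Function.Exact (Submodule.subtype K) (LinearMap.toSpanSingleton R W w) :=
    LinearMap.exact_subtype_ker_map _
  have hex' := Module.Flat.lTensor_exact (M := S) hex
  have h0 : (LinearMap.toSpanSingleton R W w).lTensor S (s ⊗ₜ[R] (1 : R)) = 0 := by
    simpa using h
  obtain ⟨y, hy⟩ := (hex' _).1 h0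
  have key : ∀ y : S ⊗[R] K, TensorProduct.rid R S ((Submodule.subtype K).lTensor S y) ∈
      K.map (algebraMap R S) := by
    intro y
    induction y with
    | zero => simp
    | add a b ha hb => rw [map_add, map_add]; exact add_mem ha hb
    | tmul a b =>
      simp only [LinearMap.lTensor_tmul, Submodule.subtype_apply, rid_tmul, Algebra.smul_def]
      exact Ideal.mul_mem_right _ _ (Ideal.mem_map_of_mem _ b.2)
  have := key y
  rw [hy] at this
  simpa using this

end

section
variable {R S E : Type*} [CommRing R] [CommRing S] [Algebra R S] [Module.Flat R S]
  [AddCommGroup E] [Module R E]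

/-- An element of `S ⊗ E` killed by every generator of a finitely generated ideal `m` comes from
the cyclic submodule of `E` annihilated by `m`. -/
theorem exists_eq_tmul_of_forall_smul_eq_zero {m : Ideal R} (hm : m.FG) {ε : E}
    (hε : ∀ e : E, (∀ r ∈ m, r • e = 0) ↔ ∃ r : R, r • ε = e)
    {g : S ⊗[R] E} (hg : ∀ r ∈ m, r • g = 0) : ∃ s : S, g = s ⊗ₜ ε := by
  obtain ⟨k, v, hv⟩ := Submodule.fg_iff_exists_fin_generating_family.1 hm
  let h : E →ₗ[R] (Fin k → E) := LinearMap.pi fun i => LinearMap.lsmul R E (v i)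
  have hex : Function.Exact (LinearMap.toSpanSingleton R E ε) h := by
    intro e
    have h1 : h e = 0 ↔ ∀ r ∈ m, r • e = 0 := by
      constructor
      · intro he r hr
        have : m ≤ LinearMap.ker (LinearMap.toSpanSingleton R E e) := by
          rw [← hv, Submodule.span_le]
          rintro _ ⟨i, rfl⟩
          exact congrFun he i
        exact this hr
      · intro he
        funext i
        exact he _ (hv ▸ Submodule.subset_span ⟨i, rfl⟩)
    rw [h1, hε]
    rfl
  have hex' := Module.Flat.lTensor_exact (M := S) hex
  have h0 : h.lTensor S g = 0 := by
    apply (TensorProduct.piRight R R S (fun _ : Fin k => E)).injective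
    rw [map_zero]
    funext i
    have : ∀ x : S ⊗[R] E, TensorProduct.piRight R R S (fun _ : Fin k => E) (h.lTensor S x) i
        = v i • x := by
      intro x
      induction x with
      | zero => simp
      | add a b ha hb => simp only [map_add, Pi.add_apply, ha, hb, smul_add]
      | tmul a b => simp [h]
    rw [this]
    exact hg _ (hv ▸ Submodule.subset_span ⟨i, rfl⟩)
  obtain ⟨y, hy⟩ := (hex' _).1 h0
  refine ⟨TensorProduct.rid R S y, ?_⟩
  rw [← hy]
  clear hy
  induction y with
  | zero => simp
  | add a b ha hb => simp only [map_add, TensorProduct.add_tmul, ha, hb]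
  | tmul a b => simp [TensorProduct.smul_tmul]

end

/-- If an ideal has a power killing `g ≠ 0`, then some nonzero multiple of `g` is killed by it. -/
theorem exists_smul_ne_zero_forall_smul_eq_zero {R M : Type*} [CommRing R] [AddCommGroup M]
    [Module R M] {m : Ideal R} {n : ℕ} {g : M} (hn : ∀ r ∈ m ^ n, r • g = 0) (hg : g ≠ 0) :
    ∃ a : R, a • g ≠ 0 ∧ ∀ r ∈ m, r • a • g = 0 := by
  induction n with
  | zero => exact absurd (by simpa using hn 1 (by simp)) hg
  | succ n ih =>
    by_cases h : ∀ r ∈ m ^ n, r • g = 0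
    · exact ih h
    · push Not at h
      obtain ⟨a, ha, hag⟩ := h
      refine ⟨a, hag, fun r hr => ?_⟩
      rw [smul_smul]
      exact hn _ (by rw [pow_succ']; exact Ideal.mul_mem_mul hr ha)

section
variable {R S E : Type*} [CommRing R] [CommRing S] [Algebra R S] [AddCommGroup E] [Module R E]

theorem tmul_eq_zero_of_mem_map {m : Ideal R} {ε : E} (hm : ∀ r ∈ m, r • ε = 0) {s : S}
    (hs : s ∈ m.map (algebraMap R S)) : s ⊗ₜ[R] ε = 0 := by
  have : m.map (algebraMap R S) ≤ LinearMap.ker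
      ((TensorProduct.AlgebraTensorModule.mk R S S E).flip ε) := by
    rw [Ideal.map_le_iff_le_comap]
    intro r hr
    change algebraMap R S r ⊗ₜ[R] ε = 0
    rw [Algebra.algebraMap_eq_smul_one, TensorProduct.smul_tmul, hm r hr, TensorProduct.tmul_zero]
  exact this hs

/-- If `E` has simple essential socle generated by `ε` and the closed fiber of the flat map
`R → S` has simple essential socle generated by the class of `u`, then `u ⊗ ε` lies in every
nonzero submodule of `S ⊗ E`. -/
theorem exists_smul_eq_tmul_socle [IsLocalRing R] [Module.Flat R S]
    (hfg : (maximalIdeal R).FG) (hnil : IsNilpotent (maximalIdeal R))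
    {ε : E} (hε0 : ε ≠ 0) (hmε : ∀ r ∈ maximalIdeal R, r • ε = 0)
    (hsoc : ∀ e : E, e ≠ 0 → ∃ r : R, r • e = ε) {u : S}
    (hu : ∀ s ∉ (maximalIdeal R).map (algebraMap R S),
      ∃ a, u - a * s ∈ (maximalIdeal R).map (algebraMap R S))
    {g : S ⊗[R] E} (hg : g ≠ 0) : ∃ b : S, b • g = u ⊗ₜ ε := by
  obtain ⟨n, hn⟩ := hnil
  obtain ⟨a, hag, ha⟩ := exists_smul_ne_zero_forall_smul_eq_zero (m := maximalIdeal R) (n := n)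
    (fun r hr => by rw [hn] at hr; rw [(Submodule.mem_bot _).1 hr, zero_smul]) hg
  have hε : ∀ e : E, (∀ r ∈ maximalIdeal R, r • e = 0) ↔ ∃ r : R, r • ε = e := by
    intro e
    constructor
    · intro he
      by_cases h0 : e = 0
      · exact ⟨0, by simp [h0]⟩
      obtain ⟨r, hr⟩ := hsoc e h0
      have hru : IsUnit r := by
        by_contra h
        exact hε0 (hr ▸ he r h)
      exact ⟨hru.unit⁻¹.val, by rw [← hr, smul_smul, IsUnit.val_inv_mul, one_smul]⟩
    · rintro ⟨r, rfl⟩ x hx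
      rw [smul_comm, hmε x hx, smul_zero]
  obtain ⟨s, hs⟩ := exists_eq_tmul_of_forall_smul_eq_zero hfg hε ha
  have hsm : s ∉ (maximalIdeal R).map (algebraMap R S) := fun h =>
    hag (hs.trans (tmul_eq_zero_of_mem_map hmε h))
  obtain ⟨b, hb⟩ := hu s hsm
  have h1 := tmul_eq_zero_of_mem_map hmε hb
  rw [TensorProduct.sub_tmul, sub_eq_zero] at h1
  refine ⟨b * algebraMap R S a, ?_⟩
  rw [h1, mul_smul, algebraMap_smul, hs, TensorProduct.smul_tmul', smul_eq_mul]

/-- Flat base change of a faithful module with a finite faithful family is faithful. -/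
theorem eq_zero_of_forall_smul_tmul_eq_zero [Module.Flat R S] {l : ℕ} {v : Fin l → E}
    (hv : ∀ r : R, (∀ i, r • v i = 0) → r = 0) {s : S}
    (hs : ∀ g : S ⊗[R] E, s • g = 0) : s = 0 := by
  let h : R →ₗ[R] (Fin l → E) := LinearMap.pi fun i => LinearMap.toSpanSingleton R E (v i)
  have hinj : Function.Injective h := by
    rw [← LinearMap.ker_eq_bot, LinearMap.ker_eq_bot']
    intro r hr
    exact hv r fun i => congrFun hr i
  have hinj' := Module.Flat.lTensor_preserves_injective_linearMap (M := S) h hinj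
  have : s ⊗ₜ[R] (1 : R) = 0 := by
    apply hinj'
    apply (TensorProduct.piRight R R S (fun _ : Fin l => E)).injective
    rw [map_zero, map_zero]
    funext i
    have := hs (1 ⊗ₜ v i)
    simpa [h, TensorProduct.smul_tmul'] using this
  simpa using congrArg (TensorProduct.rid R S) this

end

/-- A bilinear-pairing criterion: if a faithful `S`-module `G`, finite over a field `k`, has a
socle element in each nonzero submodule, and `G` embeds `S`-linearly into an `S`-module `G'` by
`g ↦ β g c`, then there is an `S`-linear retraction sending `c` to `1`. -/
theorem exists_linearMap_eq_one_of_pairing {k S T G G' : Type*} [Field k] [CommRing S] [Algebra k S]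
    [FiniteDimensional k S] [AddCommGroup T] [Module S T] [AddCommGroup G] [Module S G]
    [AddCommGroup G'] [Module S G']
    (hfaith : ∀ s : S, (∀ g : G, s • g = 0) → s = 0)
    {σ : G} (hσ0 : σ ≠ 0) (hσ : ∀ g : G, g ≠ 0 → ∃ b : S, b • g = σ)
    (β : G →ₗ[S] T →ₗ[S] G') {c : T} (hc : β σ c ≠ 0) :
    ∃ φ : T →ₗ[S] S, φ c = 1 := by
  let _ : Module k T := Module.compHom T (algebraMap k S)
  let _ : Module k G := Module.compHom G (algebraMap k S)
  let _ : Module k G' := Module.compHom G' (algebraMap k S)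
  have : IsScalarTower k S T := ⟨fun a b c => by rw [Algebra.smul_def, mul_smul]; rfl⟩
  have : IsScalarTower k S G := ⟨fun a b c => by rw [Algebra.smul_def, mul_smul]; rfl⟩
  have : IsScalarTower k S G' := ⟨fun a b c => by rw [Algebra.smul_def, mul_smul]; rfl⟩
  obtain ⟨f, hf⟩ := Module.Projective.exists_dual_eq_one k hσ0
  have hfne : ∀ g : G, g ≠ 0 → ∃ b : S, f (b • g) = 1 := fun g hg => by
    obtain ⟨b, hb⟩ := hσ g hg
    exact ⟨b, hb ▸ hf⟩
  let ι : G →ₗ[S] G' := β.flip c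
  have hι : Function.Injective (ι.restrictScalars k) := by
    rw [← LinearMap.ker_eq_bot, LinearMap.ker_eq_bot']
    intro g hg
    by_contra hne
    obtain ⟨b, hb⟩ := hσ g hne
    apply hc
    rw [← hb, map_smul, LinearMap.smul_apply]
    change b • ι g = 0
    rw [show ι g = 0 from hg, smul_zero]
  obtain ⟨ρ, hρ⟩ := LinearMap.exists_leftInverse_of_injective _ (LinearMap.ker_eq_bot.2 hι)
  let Ψ : G' →ₗ[k] k := f ∘ₗ ρ
  have hΨ : ∀ g : G, Ψ (β g c) = f g := fun g => congrArg f (LinearMap.congr_fun hρ g)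
  let act : S →ₗ[k] G →ₗ[k] G := (Algebra.lsmul k k G).toLinearMap
  let γ : S →ₗ[k] Module.Dual k G := (LinearMap.llcomp k G G k f) ∘ₗ act
  have hγ : ∀ s g, γ s g = f (s • g) := fun _ _ => rfl
  have hγinj : Function.Injective γ := by
    rw [← LinearMap.ker_eq_bot, LinearMap.ker_eq_bot']
    intro s hs
    refine hfaith s fun g => ?_
    by_contra hne
    obtain ⟨b, hb⟩ := hfne _ hne
    have := LinearMap.congr_fun hs (b • g)
    rw [hγ, smul_comm, hb] at this
    exact one_ne_zero this
  have hαinj : Function.Injective γ.flip := by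
    rw [← LinearMap.ker_eq_bot, LinearMap.ker_eq_bot']
    intro g hg
    by_contra hne
    obtain ⟨b, hb⟩ := hfne _ hne
    have := LinearMap.congr_fun hg b
    rw [LinearMap.flip_apply, hγ, hb] at this
    exact one_ne_zero this
  have : FiniteDimensional k G := FiniteDimensional.of_injective γ.flip hαinj
  have hrank : Module.finrank k S = Module.finrank k (Module.Dual k G) := by
    apply le_antisymm (LinearMap.finrank_le_finrank_of_injective hγinj)
    rw [Subspace.dual_finrank_eq, ← Subspace.dual_finrank_eq (V := S)]
    exact LinearMap.finrank_le_finrank_of_injective hαinj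
  have hsurj : Function.Surjective γ :=
    (LinearMap.injective_iff_surjective_of_finrank_eq_finrank hrank).1 hγinj
  have key : ∀ t : T, ∃ s : S, ∀ g : G, f (s • g) = Ψ (β g t) := by
    intro t
    obtain ⟨s, hs⟩ := hsurj (Ψ ∘ₗ (β.flip t).restrictScalars k)
    exact ⟨s, fun g => LinearMap.congr_fun hs g⟩
  choose φ hφ using key
  have hext : ∀ s s' : S, (∀ g : G, f (s • g) = f (s' • g)) → s = s' := fun s s' h =>
    hγinj (LinearMap.ext h)
  refine ⟨{ toFun := φ, map_add' := fun a b => ?_, map_smul' := fun a b => ?_ }, ?_⟩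
  · refine hext _ _ fun g => ?_
    rw [hφ, map_add (β g), map_add Ψ, add_smul, map_add f, hφ, hφ]
  · refine hext _ _ fun g => ?_
    rw [hφ, RingHom.id_apply, smul_eq_mul, mul_comm, mul_smul, hφ, map_smul (β g), map_smul β,
      LinearMap.smul_apply]
  · refine hext _ _ fun g => ?_
    change f (φ c • g) = _
    rw [hφ, hΨ, one_smul]

section
variable {R₀ R₁ S₀ S₁ E : Type*} [CommRing R₀] [CommRing R₁] [CommRing S₀] [CommRing S₁]
  [Algebra R₀ R₁] [Algebra R₀ S₀] [Algebra R₀ S₁] [Algebra R₁ S₁] [Algebra S₀ S₁]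
  [IsScalarTower R₀ R₁ S₁] [IsScalarTower R₀ S₀ S₁] [AddCommGroup E] [Module R₀ E]

/-- If `R₀ → R₁` splits off `c` and `R₁ → S₁` is local-flat, then `c x ⊗ ε ≠ 0` in `S₁ ⊗ E`
for `ε ≠ 0` and `x` outside the extended maximal ideal. -/
theorem mul_tmul_ne_zero [Module.Flat R₁ S₁] [IsLocalRing R₁] {c : R₁} (θ : R₁ →ₗ[R₀] R₀)
    (hθ : θ c = 1) {ε : E} (hε : ε ≠ 0) {x : S₁}
    (hx : x ∉ (maximalIdeal R₁).map (algebraMap R₁ S₁)) :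
    (x * algebraMap R₁ S₁ c) ⊗ₜ[R₀] ε ≠ 0 := by
  intro h
  have hw : c ⊗ₜ[R₀] ε ≠ 0 := by
    intro h0
    have := congrArg (fun y => TensorProduct.lid R₀ E (θ.rTensor E y)) h0
    simp [hθ, hε] at this
  have h1 : x ⊗ₜ[R₁] (c ⊗ₜ[R₀] ε) = 0 := by
    apply (TensorProduct.AlgebraTensorModule.cancelBaseChange R₀ R₁ S₁ S₁ E).injective
    rw [map_zero, TensorProduct.AlgebraTensorModule.cancelBaseChange_tmul, Algebra.smul_def,
      mul_comm, h]
  refine hx (Ideal.map_mono (le_maximalIdeal ?_) (mem_map_ker_of_tmul_eq_zero h1))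
  intro htop
  apply hw
  have : (1 : R₁) ∈ LinearMap.ker (LinearMap.toSpanSingleton R₁ _ (c ⊗ₜ[R₀] ε)) := by
    rw [show LinearMap.ker _ = ⊤ from htop]; trivial
  simpa using this

/-- Artinian form of the extension of a splitting along a flat map with Gorenstein fiber. -/
theorem exists_linearMap_eq_one_of_flat_of_socle {k : Type*} [Field k] [Algebra k S₀]
    [FiniteDimensional k S₀] [IsLocalRing R₀] [Module.Flat R₀ S₀]
    [Module.Flat R₁ S₁] [IsLocalRing R₁]
    (hfg : (maximalIdeal R₀).FG) (hnil : IsNilpotent (maximalIdeal R₀))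
    {ε : E} (hε0 : ε ≠ 0) (hmε : ∀ r ∈ maximalIdeal R₀, r • ε = 0)
    (hsoc : ∀ e : E, e ≠ 0 → ∃ r : R₀, r • e = ε)
    {l : ℕ} {v : Fin l → E} (hv : ∀ r : R₀, (∀ i, r • v i = 0) → r = 0)
    {c : R₁} (θ : R₁ →ₗ[R₀] R₀) (hθ : θ c = 1) {u : S₀}
    (hu : ∀ s ∉ (maximalIdeal R₀).map (algebraMap R₀ S₀),
      ∃ a, u - a * s ∈ (maximalIdeal R₀).map (algebraMap R₀ S₀))
    (hu₁ : algebraMap S₀ S₁ u ∉ (maximalIdeal R₁).map (algebraMap R₁ S₁)) :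
    ∃ φ : S₁ →ₗ[S₀] S₀, φ (algebraMap R₁ S₁ c) = 1 := by
  let β : S₀ ⊗[R₀] E →ₗ[S₀] S₁ →ₗ[S₀] S₁ ⊗[R₀] E :=
    (LinearMap.flip
      { toFun := fun x => TensorProduct.AlgebraTensorModule.map
          (LinearMap.toSpanSingleton S₀ S₁ x) (LinearMap.id (R := R₀) (M := E))
        map_add' := fun x y => by ext; simp [TensorProduct.add_tmul]
        map_smul' := fun a x => by ext; simp [TensorProduct.smul_tmul'] })
  have hβ : ∀ s e x, β (s ⊗ₜ e) x = (s • x) ⊗ₜ e := fun _ _ _ => rfl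
  have hne : β (u ⊗ₜ ε) (algebraMap R₁ S₁ c) ≠ 0 := by
    rw [hβ, Algebra.smul_def]
    exact mul_tmul_ne_zero θ hθ hε0 hu₁
  refine exists_linearMap_eq_one_of_pairing (k := k) (σ := u ⊗ₜ[R₀] ε)
    (fun s hs => eq_zero_of_forall_smul_tmul_eq_zero hv hs) ?_
    (fun g hg => exists_smul_eq_tmul_socle hfg hnil hε0 hmε hsoc hu hg) β hne
  intro h
  rw [h] at hne
  simp at hne

end

universe u v in
/-- The dual of a finite-dimensional local algebra is a faithful module with simple essential
socle. -/
theorem exists_faithful_module_with_simple_socle (k : Type u) (R : Type v) [Field k] [CommRing R]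
    [IsLocalRing R] [Algebra k R] [FiniteDimensional k R] :
    ∃ (E : Type (max u v)) (_ : AddCommGroup E) (_ : Module R E) (ε : E) (l : ℕ) (v : Fin l → E),
      ε ≠ 0 ∧ (∀ r ∈ maximalIdeal R, r • ε = 0) ∧ (∀ e : E, e ≠ 0 → ∃ r : R, r • e = ε) ∧
      ∀ r : R, (∀ i, r • v i = 0) → r = 0 := by
  let mod : Module R (Module.Dual k R) :=
    { smul := fun r f => f ∘ₗ LinearMap.mulLeft k r
      one_smul := fun f => LinearMap.ext fun x => congrArg f (one_mul x)
      mul_smul := fun a b f => LinearMap.ext fun x => congrArg f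
        (show a * b * x = b * (a * x) by ring)
      smul_zero := fun a => rfl
      smul_add := fun a f g => rfl
      add_smul := fun a b f => LinearMap.ext fun x =>
        (congrArg f (add_mul a b x)).trans (map_add f _ _)
      zero_smul := fun f => LinearMap.ext fun x => (congrArg f (zero_mul x)).trans (map_zero f) }
  have hsmul : ∀ (r : R) (f : Module.Dual k R) (x : R), (r • f) x = f (r * x) :=
    fun _ _ _ => rfl
  obtain ⟨ε, hε, hmε⟩ := Submodule.exists_dual_map_eq_bot_of_notMem
    (p := (maximalIdeal R).restrictScalars k) (x := 1)
    (fun h => (Ideal.ne_top_iff_one _).1 (maximalIdeal.isMaximal R).ne_top h) inferInstance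
  have hmε' : ∀ r ∈ maximalIdeal R, ε r = 0 := fun r hr => by
    have : ε r ∈ ((maximalIdeal R).restrictScalars k).map ε := ⟨r, hr, rfl⟩
    rwa [hmε, Submodule.mem_bot] at this
  let b := Module.finBasis k (Module.Dual k R)
  refine ⟨Module.Dual k R, inferInstance, mod, ε, _, b, ?_, ?_, ?_, ?_⟩
  · rintro rfl
    exact hε rfl
  · intro r hr
    ext x
    rw [hsmul]
    exact hmε' _ (Ideal.mul_mem_right _ _ hr)
  · intro f hf
    let W : Submodule k (Module.Dual k R) := LinearMap.range
      ({ toFun := fun r => r • f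
         map_add' := fun a b => add_smul a b f
         map_smul' := fun a r => LinearMap.ext fun x => by
          simp [hsmul] } : R →ₗ[k] Module.Dual k R)
    suffices ε ∈ W from this
    rw [← Subspace.dualCoannihilator_dualAnnihilator_eq (W := W), Submodule.mem_dualAnnihilator]
    intro w hw
    apply hmε'
    rw [Submodule.mem_dualCoannihilator] at hw
    rw [mem_maximalIdeal, mem_nonunits_iff]
    intro hu
    apply hf
    ext x
    have := hw ((x * hu.unit⁻¹.val) • f) ⟨_, rfl⟩
    rwa [hsmul, mul_assoc, IsUnit.val_inv_mul, mul_one] at this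
  · intro r hr
    rw [← Module.forall_dual_apply_eq_zero_iff k]
    intro f
    have h0 : ∀ f : Module.Dual k R, f r = 0 := by
      let ev : Module.Dual k R →ₗ[k] k := Module.Dual.eval k R r
      have : ev = 0 := b.ext fun i => by
        have := LinearMap.congr_fun (hr i) 1
        rwa [hsmul, mul_one] at this
      exact fun f => LinearMap.congr_fun this f
    exact h0 f

theorem RingHom.Finite.of_forall_exists_eq_sum {A B : Type*} [CommRing A] [CommRing B] {f : A →+* B}
    (s : Finset B) (hs : ∀ x : B, ∃ a : B → A, x = ∑ i ∈ s, f (a i) * i) : f.Finite := by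
  let _ := f.toAlgebra
  refine ⟨⟨s, ?_⟩⟩
  rw [eq_top_iff]
  intro x _
  obtain ⟨a, ha⟩ := hs x
  rw [ha]
  exact Submodule.sum_mem _ fun i hi => Submodule.smul_mem _ (a i) (Submodule.subset_span hi)

theorem IsFFinite.finite_frobenius {R : Type*} [CommRing R] {p : ℕ} [ExpChar R p]
    (h : IsFFinite R p) : (frobenius R p).Finite :=
  let ⟨s, hs⟩ := h
  RingHom.Finite.of_forall_exists_eq_sum s hs

theorem IsFFinite.finite_iterateFrobenius {R : Type*} [CommRing R] {p : ℕ} [ExpChar R p]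
    (h : IsFFinite R p) (e : ℕ) : (iterateFrobenius R p e).Finite := by
  induction e with
  | zero =>
    rw [iterateFrobenius_zero]
    exact RingHom.Finite.id R
  | succ e ih =>
    have : iterateFrobenius R p (e + 1) = (frobenius R p).comp (iterateFrobenius R p e) := by
      ext x
      simp [iterateFrobenius_def, frobenius_def, pow_succ, pow_mul]
    rw [this]
    exact h.finite_frobenius.comp ih

/-- A quotient of an F-finite local ring by an ideal primary to the maximal ideal is a
finite-dimensional algebra over the residue field through a power of Frobenius. -/
theorem IsFFinite.exists_finiteDimensional_quotient {R : Type*} [CommRing R] [IsLocalRing R]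
    {p : ℕ} [ExpChar R p] (hp : 1 < p) (h : IsFFinite R p) {I : Ideal R} {n : ℕ}
    (hI : maximalIdeal R ^ n ≤ I) :
    ∃ _ : Algebra (ResidueField R) (R ⧸ I), FiniteDimensional (ResidueField R) (R ⧸ I) := by
  let f : R →+* R ⧸ I := (Ideal.Quotient.mk I).comp (iterateFrobenius R p n)
  have hf : ∀ a ∈ maximalIdeal R, f a = 0 := by
    intro a ha
    refine Ideal.Quotient.eq_zero_iff_mem.2 (hI ?_)
    rw [iterateFrobenius_def]
    exact Ideal.pow_le_pow_right (Nat.lt_pow_self hp).le (Ideal.pow_mem_pow ha _)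
  let g : ResidueField R →+* R ⧸ I := Ideal.Quotient.lift _ f hf
  have hg : g.Finite := by
    refine RingHom.Finite.of_comp_finite (f := residue R) ?_
    change f.Finite
    exact (RingHom.Finite.of_surjective _ Ideal.Quotient.mk_surjective).comp
      (h.finite_iterateFrobenius n)
  exact ⟨g.toAlgebra, hg⟩

/-- Over a Noetherian local ring, a functional on a finite module with prescribed value `1` at `x`
exists as soon as it exists modulo all powers of the maximal ideal. -/
theorem exists_linearMap_eq_one_of_forall_quotient {S M : Type*} [CommRing S] [IsNoetherianRing S]
    [IsLocalRing S] [AddCommGroup M] [Module S M] [Module.Finite S M] {x : M}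
    (h : ∀ n : ℕ, ∃ φ : M →ₗ[S] S ⧸ maximalIdeal S ^ n, φ x = 1) :
    ∃ φ : M →ₗ[S] S, φ x = 1 := by
  obtain ⟨l, π, hπ⟩ := Module.Finite.exists_fin' S M
  obtain ⟨m, v, hv⟩ := Submodule.fg_iff_exists_fin_generating_family.1
    (IsNoetherian.noetherian (LinearMap.ker π))
  obtain ⟨a, ha⟩ := hπ x
  let T : ((Fin l → S) →ₗ[S] S) →ₗ[S] (Fin m → S) × S :=
    (LinearMap.pi fun j => LinearMap.applyₗ (v j)).prod (LinearMap.applyₗ a)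
  have hT : ∀ ψ, T ψ = (fun j => ψ (v j), ψ a) := fun _ => rfl
  suffices ((0, 1) : (Fin m → S) × S) ∈ LinearMap.range T by
    obtain ⟨ψ, hψ⟩ := this
    rw [hT, Prod.mk.injEq] at hψ
    have hker : LinearMap.ker π ≤ LinearMap.ker ψ := by
      rw [← hv, Submodule.span_le]
      rintro _ ⟨j, rfl⟩
      exact congrFun hψ.1 j
    refine ⟨(LinearMap.ker π).liftQ ψ hker ∘ₗ
      (LinearMap.quotKerEquivOfSurjective π hπ).symm.toLinearMap, ?_⟩
    have : (LinearMap.quotKerEquivOfSurjective π hπ).symm x = Submodule.Quotient.mk a := by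
      rw [LinearEquiv.symm_apply_eq, ← ha]
      rfl
    rw [LinearMap.comp_apply, LinearEquiv.coe_coe, this, Submodule.liftQ_apply, hψ.2]
  let Q := ((Fin m → S) × S) ⧸ LinearMap.range T
  have hbot := Ideal.iInf_pow_smul_eq_bot_of_isLocalRing (M := Q) (maximalIdeal S)
    (maximalIdeal.isMaximal S).ne_top
  rw [← Submodule.Quotient.mk_eq_zero, ← Submodule.mem_bot S, ← hbot, Submodule.mem_iInf]
  intro n
  obtain ⟨φ, hφ⟩ := h n
  have hlift : ∃ ψ : (Fin l → S) →ₗ[S] S, (maximalIdeal S ^ n).mkQ ∘ₗ ψ = φ ∘ₗ π :=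
    Module.projective_lifting_property _ _ (Submodule.mkQ_surjective _)
  obtain ⟨ψ, hψ⟩ := hlift
  have h1 : ∀ y, Ideal.Quotient.mk (maximalIdeal S ^ n) (ψ y) = φ (π y) :=
    fun y => LinearMap.congr_fun hψ y
  have h2 : (Submodule.Quotient.mk (0, 1) : Q) = Submodule.Quotient.mk ((0, 1) - T ψ) := by
    rw [Submodule.Quotient.eq, sub_sub_cancel]
    exact ⟨ψ, rfl⟩
  rw [h2]
  have hv0 : ∀ j, ψ (v j) ∈ maximalIdeal S ^ n := fun j => by
    rw [← Ideal.Quotient.eq_zero_iff_mem, h1]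
    have : v j ∈ LinearMap.ker π := hv ▸ Submodule.subset_span ⟨j, rfl⟩
    rw [LinearMap.mem_ker.1 this, map_zero]
  have ha1 : 1 - ψ a ∈ maximalIdeal S ^ n := by
    rw [← Ideal.Quotient.eq_zero_iff_mem, map_sub, h1, ha, hφ, map_one, sub_self]
  have h3 : (0, 1) - T ψ ∈ maximalIdeal S ^ n • (⊤ : Submodule S ((Fin m → S) × S)) := by
    have : (0, 1) - T ψ = (1 - ψ a) • ((0, 1) : (Fin m → S) × S)
        - ∑ j, ψ (v j) • ((Pi.single j 1, 0) : (Fin m → S) × S) := by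
      rw [hT]
      ext i
      · simp [Prod.fst_sum, Finset.sum_apply, Pi.single_apply]
      · simp [Prod.snd_sum]
    rw [this]
    exact sub_mem (Submodule.smul_mem_smul ha1 trivial)
      (sum_mem fun j _ => Submodule.smul_mem_smul (hv0 j) trivial)
  have h4 := Submodule.mem_map_of_mem (f := (LinearMap.range T).mkQ) h3
  rw [Submodule.map_smul''] at h4
  exact Submodule.smul_mono le_rfl le_top h4

section
variable {R S : Type*} [CommRing R] [CommRing S] [Algebra R S]

/-- If `z` is a nonzerodivisor on the fiber `S / m S` over a maximal ideal `m`, then it is a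
nonzerodivisor on `S ⊗ N` for every module `N` over the flat base killed by `m`. -/
theorem eq_zero_of_smul_eq_zero_of_annihilated [Module.Flat R S] {m : Ideal R} [m.IsMaximal]
    {z : S} (hz : ∀ s : S, z * s ∈ m.map (algebraMap R S) → s ∈ m.map (algebraMap R S))
    {N : Type*} [AddCommGroup N] [Module R N] (hN : ∀ r ∈ m, ∀ x : N, r • x = 0)
    {g : S ⊗[R] N} (hg : z • g = 0) : g = 0 := by
  classical
  let _ : Field (R ⧸ m) := Ideal.Quotient.field m
  let _ : Module (R ⧸ m) N := Module.IsTorsionBySet.module (I := m) (fun x r => hN r r.2 x)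
  have : IsScalarTower R (R ⧸ m) N := ⟨fun r a x => by
    obtain ⟨a, rfl⟩ := Ideal.Quotient.mk_surjective a
    exact mul_smul r a x⟩
  let b := Module.Basis.ofVectorSpace (R ⧸ m) N
  let e : N ≃ₗ[R] (Module.Basis.ofVectorSpaceIndex (R ⧸ m) N →₀ R ⧸ m) := b.repr.restrictScalars R
  let E := (TensorProduct.AlgebraTensorModule.congr (LinearEquiv.refl S S) e).trans
    (TensorProduct.finsuppRight R S S (R ⧸ m) _)
  apply E.injective
  rw [map_zero]
  ext1 i
  have h1 : z • E g i = 0 := by rw [← Finsupp.smul_apply, ← map_smul, hg, map_zero]; rfl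
  generalize E g i = y at h1
  obtain ⟨s, rfl⟩ : ∃ s : S, y = s ⊗ₜ (1 : R ⧸ m) := by
    clear h1
    induction y with
    | zero => exact ⟨0, by simp⟩
    | add a b ha hb =>
      obtain ⟨s, rfl⟩ := ha
      obtain ⟨t, rfl⟩ := hb
      exact ⟨s + t, (TensorProduct.add_tmul _ _ _).symm⟩
    | tmul s a =>
      obtain ⟨a, rfl⟩ := Ideal.Quotient.mk_surjective a
      refine ⟨a • s, ?_⟩
      rw [TensorProduct.smul_tmul, ← Algebra.algebraMap_eq_smul_one]
      rfl
  have hker : LinearMap.ker (LinearMap.toSpanSingleton R (R ⧸ m) 1) = m := by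
    ext r
    rw [LinearMap.mem_ker, LinearMap.toSpanSingleton_apply, ← Algebra.algebraMap_eq_smul_one]
    exact Ideal.Quotient.eq_zero_iff_mem
  rw [TensorProduct.smul_tmul', smul_eq_mul] at h1
  have h2 := mem_map_ker_of_tmul_eq_zero h1
  rw [hker] at h2
  refine tmul_eq_zero_of_mem_map (m := m) (fun r hr => ?_) (hz s h2)
  rw [← Algebra.algebraMap_eq_smul_one]
  exact Ideal.Quotient.eq_zero_iff_mem.2 hr

/-- If `z` is a nonzerodivisor on the fiber `S / m S` over a maximal ideal `m`, then it is a
nonzerodivisor on `S ⊗ N` for every module `N` over the flat base killed by a power of `m`. -/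
theorem eq_zero_of_smul_eq_zero_of_pow_annihilated [Module.Flat R S] {m : Ideal R} [m.IsMaximal]
    {z : S} (hz : ∀ s : S, z * s ∈ m.map (algebraMap R S) → s ∈ m.map (algebraMap R S))
    (n : ℕ) {N : Type*} [AddCommGroup N] [Module R N] (hN : ∀ r ∈ m ^ n, ∀ x : N, r • x = 0)
    {g : S ⊗[R] N} (hg : z • g = 0) : g = 0 := by
  induction n generalizing N with
  | zero =>
    refine eq_zero_of_smul_eq_zero_of_annihilated hz (fun r _ x => ?_) hg
    have hx : x = 0 := by simpa using hN 1 (by simp) x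
    rw [hx, smul_zero]
  | succ n ih =>
    let N' : Submodule R N := m • ⊤
    have hex := lTensor_exact S (LinearMap.exact_subtype_mkQ N') (Submodule.mkQ_surjective N')
    have h1 : z • N'.mkQ.lTensor S g = 0 := by
      rw [← LinearMap.baseChange_eq_ltensor, ← map_smul, hg, map_zero]
    have h2 : N'.mkQ.lTensor S g = 0 := by
      refine eq_zero_of_smul_eq_zero_of_annihilated hz (fun r hr x => ?_) h1
      obtain ⟨x, rfl⟩ := N'.mkQ_surjective x
      rw [← map_smul, Submodule.mkQ_apply, Submodule.Quotient.mk_eq_zero]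
      exact Submodule.smul_mem_smul hr trivial
    obtain ⟨g', rfl⟩ := (hex g).1 h2
    have hinj := Module.Flat.lTensor_preserves_injective_linearMap (M := S) N'.subtype
      N'.injective_subtype
    rw [ih (g := g') (fun r hr x => ?_) ?_, map_zero]
    · apply hinj
      rw [map_zero, ← hg, ← LinearMap.baseChange_eq_ltensor, map_smul]
    · apply Subtype.ext
      rw [Submodule.coe_smul, Submodule.coe_zero]
      have : N' ≤ LinearMap.ker (LinearMap.lsmul R N r) := by
        refine Submodule.smul_le.2 fun a ha y _ => ?_
        rw [LinearMap.mem_ker, LinearMap.lsmul_apply, smul_smul]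
        exact hN _ (by rw [pow_succ]; exact Ideal.mul_mem_mul hr ha) y
      exact this x.2

theorem LinearMap.rTensor_mulLeft_apply {M : Type*} [AddCommGroup M] [Module R M] (z : S)
    (w : S ⊗[R] M) : (LinearMap.mulLeft R z).rTensor M w = z • w := by
  induction w with
  | zero => simp
  | add a b ha hb => rw [map_add, ha, hb, smul_add]
  | tmul a b => rfl

/-- Over a base with nilpotent maximal ideal `m`, flatness passes to the quotient by an element
that is a nonzerodivisor on the fiber. -/
theorem Module.Flat.of_exact_mul_of_fiber [Module.Flat R S] {m : Ideal R} [m.IsMaximal]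
    (hm : IsNilpotent m) {z : S}
    (hz : ∀ s : S, z * s ∈ m.map (algebraMap R S) → s ∈ m.map (algebraMap R S))
    {T : Type*} [AddCommGroup T] [Module R T] (π : S →ₗ[R] T) (hπ : Function.Surjective π)
    (hex : Function.Exact (LinearMap.mulLeft R z) π) : Module.Flat R T := by
  obtain ⟨n, hn⟩ := hm
  rw [Module.Flat.iff_lTensor_preserves_injective_linearMap]
  intro N' N _ _ _ _ f hf
  rw [← LinearMap.ker_eq_bot, LinearMap.ker_eq_bot']
  intro y hy
  obtain ⟨x, rfl⟩ := LinearMap.rTensor_surjective N' hπ y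
  have h1 : π.rTensor N (f.lTensor S x) = 0 := by
    rw [← hy]
    rw [← LinearMap.comp_apply, ← LinearMap.comp_apply, LinearMap.rTensor_comp_lTensor,
      LinearMap.lTensor_comp_rTensor]
  obtain ⟨w, hw⟩ := (_root_.rTensor_exact N hex hπ _).1 h1
  rw [LinearMap.rTensor_mulLeft_apply] at hw
  have hexq : Function.Exact f (LinearMap.range f).mkQ := LinearMap.exact_map_mkQ_range f
  have hexq' := _root_.lTensor_exact S hexq (Submodule.mkQ_surjective _)
  have h2 : (LinearMap.range f).mkQ.lTensor S w = 0 := by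
    refine eq_zero_of_smul_eq_zero_of_pow_annihilated hz n (fun r hr x => ?_) ?_
    · rw [hn] at hr
      rw [(Submodule.mem_bot _).1 hr, zero_smul]
    · rw [← LinearMap.baseChange_eq_ltensor, ← map_smul, hw, LinearMap.baseChange_eq_ltensor]
      exact hexq'.apply_apply_eq_zero x
  obtain ⟨w', rfl⟩ := (hexq' w).1 h2
  have hinj := Module.Flat.lTensor_preserves_injective_linearMap (M := S) f hf
  have h3 : z • w' = x := by
    apply hinj
    rw [← hw, ← LinearMap.baseChange_eq_ltensor, map_smul]
  rw [← h3, ← LinearMap.rTensor_mulLeft_apply]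
  exact (_root_.rTensor_exact N' hex hπ).apply_apply_eq_zero w'

end

open RingTheory.Sequence in
theorem Ideal.isWeaklyRegular_quotient_concat_iff {S : Type*} [CommRing S] (K : Ideal S)
    (zs : List S)
    (z : S) : IsWeaklyRegular (S ⧸ K) (zs ++ [z]) ↔ IsWeaklyRegular (S ⧸ K) zs ∧
      ∀ s, z * s ∈ K ⊔ Ideal.ofList zs → s ∈ K ⊔ Ideal.ofList zs := by
  have key : ∀ s : S, (Ideal.Quotient.mk K s ∈ Ideal.ofList zs • (⊤ : Submodule S (S ⧸ K))) ↔
      s ∈ K ⊔ Ideal.ofList zs := fun s => by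
    have h1 : Ideal.ofList zs • (⊤ : Submodule S (S ⧸ K)) =
        Submodule.map K.mkQ (Ideal.ofList zs) := by
      rw [← Submodule.range_mkQ K, LinearMap.range_eq_map, ← Submodule.map_smul'', smul_eq_mul,
        Ideal.mul_top]
    have h2 := Submodule.comap_map_mkQ K (Ideal.ofList zs)
    rw [h1, ← h2]
    rfl
  rw [isWeaklyRegular_append_iff, isWeaklyRegular_singleton_iff,
    isSMulRegular_quotient_iff_mem_of_smul_mem]
  refine and_congr_right fun _ => ⟨fun h s hs => (key s).1 (h _ ?_), fun h x hx => ?_⟩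
  · exact (key (z * s)).2 hs
  · obtain ⟨s, rfl⟩ := Ideal.Quotient.mk_surjective x
    exact (key s).2 (h s ((key (z * s)).1 hx))

theorem Ideal.mk_mem_map_map_mk_iff {R S : Type*} [CommRing R] [CommRing S] [Algebra R S]
    {m I : Ideal R} {J : Ideal S} [Algebra (R ⧸ I) (S ⧸ J)]
    (halg : ∀ r : R, algebraMap (R ⧸ I) (S ⧸ J) (Ideal.Quotient.mk I r) =
      Ideal.Quotient.mk J (algebraMap R S r)) {s : S} :
    Ideal.Quotient.mk J s ∈ (m.map (Ideal.Quotient.mk I)).map (algebraMap (R ⧸ I) (S ⧸ J)) ↔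
      s ∈ m.map (algebraMap R S) ⊔ J := by
  have hmap : (m.map (Ideal.Quotient.mk I)).map (algebraMap (R ⧸ I) (S ⧸ J)) =
      (m.map (algebraMap R S)).map (Ideal.Quotient.mk J) := by
    rw [Ideal.map_map, Ideal.map_map]
    congr 1
    exact RingHom.ext halg
  rw [hmap, ← Ideal.mem_comap, Ideal.comap_map_of_surjective' _ Ideal.Quotient.mk_surjective,
    Ideal.mk_ker]

theorem Module.Flat.quotient_sup_span_singleton {R S : Type*} [CommRing R] [CommRing S]
    [Algebra R S] {m : Ideal R} [m.IsMaximal] {I : Ideal R} {n : ℕ} (hI : m ^ n ≤ I)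
    (hIm : I ≤ m) {J J' : Ideal S} {z : S} (hJ' : J' = J ⊔ Ideal.span {z})
    (hz : ∀ s, z * s ∈ m.map (algebraMap R S) ⊔ J → s ∈ m.map (algebraMap R S) ⊔ J)
    [Algebra (R ⧸ I) (S ⧸ J)] (halg : ∀ r : R, algebraMap (R ⧸ I) (S ⧸ J) (Ideal.Quotient.mk I r) =
      Ideal.Quotient.mk J (algebraMap R S r))
    [Algebra (R ⧸ I) (S ⧸ J')]
    (halg' : ∀ r : R, algebraMap (R ⧸ I) (S ⧸ J') (Ideal.Quotient.mk I r) =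
      Ideal.Quotient.mk J' (algebraMap R S r)) [Module.Flat (R ⧸ I) (S ⧸ J)] :
    Module.Flat (R ⧸ I) (S ⧸ J') := by
  have hJJ : J ≤ J' := hJ' ▸ le_sup_left
  have hmax : (m.map (Ideal.Quotient.mk I)).IsMaximal := by
    refine Ideal.IsMaximal.map_of_surjective_of_ker_le Ideal.Quotient.mk_surjective ?_
    rwa [Ideal.mk_ker]
  have hnil : IsNilpotent (m.map (Ideal.Quotient.mk I)) :=
    ⟨n, by rwa [← Ideal.map_pow, Ideal.zero_eq_bot, Ideal.map_eq_bot_iff_le_ker, Ideal.mk_ker]⟩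
  let π : (S ⧸ J) →ₗ[R ⧸ I] S ⧸ J' :=
    { Ideal.Quotient.factor hJJ with
      map_smul' := fun r x => by
        obtain ⟨r, rfl⟩ := Ideal.Quotient.mk_surjective r
        obtain ⟨x, rfl⟩ := Ideal.Quotient.mk_surjective x
        change Ideal.Quotient.factor hJJ _ = _
        rw [Algebra.smul_def, halg, ← map_mul, Ideal.Quotient.factor_mk, map_mul, ← halg',
          ← Algebra.smul_def]
        rfl }
  have hπ : ∀ x, π (Ideal.Quotient.mk J x) = Ideal.Quotient.mk J' x := fun _ => rfl
  refine Module.Flat.of_exact_mul_of_fiber hnil (z := Ideal.Quotient.mk J z) (fun s => ?_) π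
    (fun y => ?_) fun x => ?_
  · obtain ⟨s, rfl⟩ := Ideal.Quotient.mk_surjective s
    rw [← map_mul, Ideal.mk_mem_map_map_mk_iff halg, Ideal.mk_mem_map_map_mk_iff halg]
    exact hz s
  · obtain ⟨y, rfl⟩ := Ideal.Quotient.mk_surjective y
    exact ⟨_, hπ y⟩
  · obtain ⟨x, rfl⟩ := Ideal.Quotient.mk_surjective x
    rw [hπ, Ideal.Quotient.eq_zero_iff_mem, hJ', sup_comm, Ideal.mem_span_singleton_sup]
    constructor
    · rintro ⟨a, b, hb, rfl⟩
      refine ⟨Ideal.Quotient.mk J a, ?_⟩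
      rw [LinearMap.mulLeft_apply, ← map_mul, map_add,
        Ideal.Quotient.eq_zero_iff_mem.2 hb, add_zero,
        mul_comm]
    · rintro ⟨a, ha⟩
      obtain ⟨a, rfl⟩ := Ideal.Quotient.mk_surjective a
      rw [LinearMap.mulLeft_apply, ← map_mul, eq_comm, Ideal.Quotient.eq] at ha
      exact ⟨a, _, ha, by ring⟩

theorem Module.Flat.quotient_of_eq_map {R S : Type*} [CommRing R] [CommRing S] [Algebra R S]
    [Module.Flat R S] {I : Ideal R} {J : Ideal S} (hJ : J = I.map (algebraMap R S))
    [inst : Algebra (R ⧸ I) (S ⧸ J)] (halg : ∀ r : R,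
      algebraMap (R ⧸ I) (S ⧸ J) (Ideal.Quotient.mk I r) =
        Ideal.Quotient.mk J (algebraMap R S r)) : Module.Flat (R ⧸ I) (S ⧸ J) := by
  subst hJ
  have h : inst = Ideal.Quotient.algebraQuotientOfLEComap Ideal.le_comap_map :=
    Algebra.algebra_ext _ _ fun r => by
    obtain ⟨r, rfl⟩ := Ideal.Quotient.mk_surjective r
    exact halg r
  subst h
  exact Module.Flat.of_linearEquiv
    (Algebra.TensorProduct.quotIdealMapEquivQuotTensor S I).toLinearEquiv

/-- Flatness over an Artinian quotient of the base of the quotient by a sequence that is regular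
on the fiber. -/
theorem Module.Flat.quotient_sup_ofList {R S : Type*} [CommRing R] [CommRing S] [Algebra R S]
    [Module.Flat R S] {m : Ideal R} [m.IsMaximal] {I : Ideal R} {n : ℕ} (hI : m ^ n ≤ I)
    (hIm : I ≤ m) {zs : List S}
    (hz : RingTheory.Sequence.IsWeaklyRegular (S ⧸ m.map (algebraMap R S)) zs)
    {J : Ideal S} (hJ : J = I.map (algebraMap R S) ⊔ Ideal.ofList zs)
    [Algebra (R ⧸ I) (S ⧸ J)] (halg : ∀ r : R, algebraMap (R ⧸ I) (S ⧸ J) (Ideal.Quotient.mk I r) =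
      Ideal.Quotient.mk J (algebraMap R S r)) : Module.Flat (R ⧸ I) (S ⧸ J) := by
  induction zs using List.reverseRecOn generalizing J with
  | nil =>
    rw [Ideal.ofList_nil, sup_bot_eq] at hJ
    exact Module.Flat.quotient_of_eq_map hJ halg
  | append_singleton zs z ih =>
    rw [Ideal.isWeaklyRegular_quotient_concat_iff] at hz
    let J₀ := I.map (algebraMap R S) ⊔ Ideal.ofList zs
    let _ : Algebra (R ⧸ I) (S ⧸ J₀) := (Ideal.quotientMap J₀ (algebraMap R S)
      (Ideal.map_le_iff_le_comap.1 le_sup_left)).toAlgebra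
    have halg₀ : ∀ r : R, algebraMap (R ⧸ I) (S ⧸ J₀) (Ideal.Quotient.mk I r) =
      Ideal.Quotient.mk J₀ (algebraMap R S r) := fun _ => rfl
    have := ih hz.1 rfl halg₀
    have hs : m.map (algebraMap R S) ⊔ J₀ = m.map (algebraMap R S) ⊔ Ideal.ofList zs := by
      have := sup_eq_left.2 (Ideal.map_mono (f := algebraMap R S) hIm)
      rw [← sup_assoc, this]
    refine Module.Flat.quotient_sup_span_singleton hI hIm (J := J₀) (z := z) ?_ ?_ halg₀ halg
    · rw [hJ, Ideal.ofList_append, Ideal.ofList_singleton, sup_assoc]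
    · rw [hs]
      exact hz.2

/-- Over a local ring, the quotient by an irreducible ideal that is primary to the maximal ideal
has a simple socle. -/
theorem Ideal.IsIrreducible.exists_socle {A : Type*} [CommRing A] [IsNoetherianRing A]
    [IsLocalRing A] {I : Ideal A} (hI : I.IsIrreducible) (hm : maximalIdeal A ≤ I.radical) :
    ∃ u ∉ I, ∀ s ∉ I, ∃ a, u - a * s ∈ I := by
  obtain ⟨n, hn⟩ := Ideal.exists_pow_le_of_le_radical_of_fg hm (IsNoetherian.noetherian _)
  have key : ∀ s ∉ I, ∃ b, b * s ∉ I ∧ ∀ r ∈ maximalIdeal A, r * (b * s) ∈ I := fun s hs => by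
    obtain ⟨b, hb, hb'⟩ := exists_smul_ne_zero_forall_smul_eq_zero (m := maximalIdeal A) (n := n)
      (g := Ideal.Quotient.mk I s)
      (fun r hr => Ideal.Quotient.eq_zero_iff_mem.2 (I.mul_mem_right s (hn hr)))
      (by rwa [Ne, Ideal.Quotient.eq_zero_iff_mem])
    exact ⟨b, fun h => hb (Ideal.Quotient.eq_zero_iff_mem.2 h),
      fun r hr => Ideal.Quotient.eq_zero_iff_mem.1 (hb' r hr)⟩
  obtain ⟨b, hu, hmu⟩ := key 1 ((Ideal.ne_top_iff_one I).1 hI.1)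
  set u := b * 1
  refine ⟨u, hu, fun s hs => ?_⟩
  obtain ⟨b', hs', -⟩ := key s hs
  have h1 : ∀ y ∉ I, I ≠ I ⊔ Ideal.span {y} := fun y hy h => hy (by
    rw [h]
    exact Ideal.mem_sup_right (Ideal.mem_span_singleton_self y))
  have h2 : ¬ (I ⊔ Ideal.span {u}) ⊓ (I ⊔ Ideal.span {s}) ≤ I := fun h =>
    (hI.2 _ _ (le_antisymm (le_inf le_sup_left le_sup_left) h)).elim (h1 u hu) (h1 s hs)
  obtain ⟨w, ⟨hwu, hws⟩, hw⟩ := SetLike.not_le_iff_exists.1 h2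
  rw [SetLike.mem_coe, sup_comm, Ideal.mem_span_singleton_sup] at hwu hws
  obtain ⟨α, i, hi, rfl⟩ := hwu
  obtain ⟨β, j, hj, hβ⟩ := hws
  have hα : IsUnit α := by
    by_contra h
    exact hw (add_mem (hmu α ((mem_maximalIdeal α).2 h)) hi)
  obtain ⟨γ, hγ⟩ := hα.exists_left_inv
  refine ⟨γ * β, ?_⟩
  have : u - γ * β * s = γ * (j - i) := by
    linear_combination (-u) * hγ - γ * hβ
  rw [this]
  exact I.mul_mem_left _ (sub_mem hj hi)

theorem Ideal.mem_of_pow_mul_mem {A : Type*} [CommRing A] {J : Ideal A} {a : A} {n : ℕ}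
    (ha : ∀ s, a * s ∈ J → s ∈ J) {s : A} (hs : a ^ n * s ∈ J) : s ∈ J := by
  induction n generalizing s with
  | zero => simpa using hs
  | succ n ih => exact ha s (ih (by rwa [← mul_assoc, ← pow_succ]))

theorem Ideal.exists_socle_sup_span_pow {A : Type*} [CommRing A] {J : Ideal A} {a u : A}
    (ha : ∀ s, a * s ∈ J → s ∈ J) (hu : u ∉ J ⊔ Ideal.span {a})
    (hu' : ∀ s ∉ J ⊔ Ideal.span {a}, ∃ b, u - b * s ∈ J ⊔ Ideal.span {a}) (t : ℕ) :
    a ^ t * u ∉ J ⊔ Ideal.span {a ^ (t + 1)} ∧ ∀ s ∉ J ⊔ Ideal.span {a ^ (t + 1)},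
      ∃ b, a ^ t * u - b * s ∈ J ⊔ Ideal.span {a ^ (t + 1)} := by
  simp only [sup_comm J, Ideal.mem_span_singleton_sup] at hu hu' ⊢
  refine ⟨?_, ?_⟩
  · rintro ⟨b, j, hj, hb⟩
    refine hu ⟨b, u - b * a, Ideal.mem_of_pow_mul_mem (n := t) ha ?_, by ring⟩
    have : a ^ t * (u - b * a) = j := by linear_combination -hb
    rwa [this]
  · induction t with
    | zero => simpa using hu'
    | succ t ih =>
      intro s hs
      by_cases h : ∃ b, ∃ j ∈ J, b * a + j = s
      · obtain ⟨s', j, hj, rfl⟩ := h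
        obtain ⟨b, c, i, hi, hb⟩ := ih s' (by
          rintro ⟨c, i, hi, rfl⟩
          exact hs ⟨c, i * a + j, add_mem (J.mul_mem_right _ hi) hj, by ring⟩)
        exact ⟨b, c, i * a - b * j, sub_mem (J.mul_mem_right _ hi) (J.mul_mem_left _ hj),
          by linear_combination a * hb⟩
      · obtain ⟨b, c, i, hi, hb⟩ := hu' s h
        exact ⟨b * a ^ (t + 1), c, a ^ (t + 1) * i, J.mul_mem_left _ hi,
          by linear_combination a ^ (t + 1) * hb⟩

open RingTheory.Sequence in
/-- Regularity of a sequence and simplicity of the socle of the quotient by it are inherited by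
the sequence of powers. -/
theorem Ideal.isWeaklyRegular_map_pow_and_exists_socle {S : Type*} [CommRing S]
    [IsNoetherianRing S] [IsLocalRing S] {K : Ideal S} (t : ℕ) (l l' : List S)
    (hmem : ∀ x ∈ l' ++ l, x ∈ maximalIdeal S) (hreg : IsWeaklyRegular (S ⧸ K) (l' ++ l))
    (hsoc : ∃ u ∉ K ⊔ Ideal.ofList (l' ++ l), ∀ s ∉ K ⊔ Ideal.ofList (l' ++ l),
      ∃ b, u - b * s ∈ K ⊔ Ideal.ofList (l' ++ l)) :
    IsWeaklyRegular (S ⧸ K) (l' ++ l.map (· ^ (t + 1))) ∧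
    ∃ u ∉ K ⊔ Ideal.ofList (l' ++ l.map (· ^ (t + 1))),
      ∀ s ∉ K ⊔ Ideal.ofList (l' ++ l.map (· ^ (t + 1))),
        ∃ b, u - b * s ∈ K ⊔ Ideal.ofList (l' ++ l.map (· ^ (t + 1))) := by
  induction l generalizing l' with
  | nil => exact ⟨hreg, hsoc⟩
  | cons a l ih =>
    have hperm : ∀ b : S, List.Perm (l' ++ b :: l) ((l' ++ l) ++ [b]) := fun b => by
      rw [List.append_assoc]
      exact (List.perm_append_singleton b l).symm.append_left l'
    have hofList : ∀ b : S, K ⊔ Ideal.ofList (l' ++ b :: l) =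
        (K ⊔ Ideal.ofList (l' ++ l)) ⊔ Ideal.span {b} := fun b => by
      rw [Ideal.ofList_append, Ideal.ofList_append, Ideal.ofList_cons]
      ac_rfl
    have hreg' := IsLocalRing.isWeaklyRegular_of_perm_of_subset_maximalIdeal hreg (hperm a) hmem
    obtain ⟨hl, ha⟩ := (Ideal.isWeaklyRegular_quotient_concat_iff K _ _).1 hreg'
    rw [hofList] at hsoc
    obtain ⟨u, hu, hu'⟩ := hsoc
    have h2 := (Ideal.isWeaklyRegular_quotient_concat_iff K _ _).2
      ⟨hl, fun _ => Ideal.mem_of_pow_mul_mem (n := t + 1) ha⟩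
    have hmem' : ∀ x ∈ l' ++ a ^ (t + 1) :: l, x ∈ maximalIdeal S := by
      intro x hx
      rw [List.mem_append, List.mem_cons] at hx
      rcases hx with hx | rfl | hx
      · exact hmem x (by simp [hx])
      · exact Ideal.pow_mem_of_mem _ (hmem a (by simp)) _ t.succ_pos
      · exact hmem x (by simp [hx])
    have h3 := IsLocalRing.isWeaklyRegular_of_perm_of_subset_maximalIdeal h2
      (hperm (a ^ (t + 1))).symm (fun x hx => hmem' x ((hperm _).mem_iff.2 hx))
    have h4 := Ideal.exists_socle_sup_span_pow ha hu hu' t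
    have := ih (l' ++ [a ^ (t + 1)])
    simp only [List.append_assoc, List.singleton_append] at this
    rw [List.map_cons]
    refine this hmem' h3 ?_
    rw [hofList]
    exact ⟨_, h4⟩

/-- A `q`-linear map descends to the quotients by an ideal and its Frobenius power. -/
theorem exists_linearMap_quotient_map {R : Type*} [CommRing R] {F : R →+* R} {θ : R →+ R}
    (hθ : ∀ a x, θ (F a * x) = a * θ x) {I : Ideal R} [Algebra (R ⧸ I) (R ⧸ I.map F)]
    (halg : ∀ r : R, algebraMap (R ⧸ I) (R ⧸ I.map F) (Ideal.Quotient.mk I r) =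
      Ideal.Quotient.mk (I.map F) (F r)) :
    ∃ θ' : (R ⧸ I.map F) →ₗ[R ⧸ I] R ⧸ I,
      ∀ x, θ' (Ideal.Quotient.mk (I.map F) x) = Ideal.Quotient.mk I (θ x) := by
  have hmem : ∀ x ∈ I.map F, θ x ∈ I := fun x hx => by
    have : ∀ b, θ (b * x) ∈ I := by
      induction hx using Submodule.span_induction with
      | mem x h =>
        obtain ⟨a, ha, rfl⟩ := h
        intro b
        rw [mul_comm, hθ]
        exact I.mul_mem_right _ ha
      | zero => simp
      | add x y _ _ hx hy => exact fun b => by rw [mul_add, map_add]; exact add_mem (hx b) (hy b)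
      | smul a x _ hx => exact fun b => by rw [smul_eq_mul, ← mul_assoc]; exact hx _
    simpa using this 1
  let g : (R ⧸ I.map F) → R ⧸ I :=
    fun x => Ideal.Quotient.mk I (θ (Function.surjInv Ideal.Quotient.mk_surjective x))
  have hg : ∀ x, g (Ideal.Quotient.mk (I.map F) x) = Ideal.Quotient.mk I (θ x) := fun x => by
    rw [Ideal.Quotient.eq, ← map_sub]
    exact hmem _ (Ideal.Quotient.eq.1 (Function.surjInv_eq Ideal.Quotient.mk_surjective _))
  refine ⟨{ toFun := g, map_add' := fun x y => ?_, map_smul' := fun r x => ?_ }, hg⟩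
  · obtain ⟨x, rfl⟩ := Ideal.Quotient.mk_surjective x
    obtain ⟨y, rfl⟩ := Ideal.Quotient.mk_surjective y
    rw [← map_add, hg, hg, hg, map_add, map_add]
  · obtain ⟨x, rfl⟩ := Ideal.Quotient.mk_surjective x
    obtain ⟨r, rfl⟩ := Ideal.Quotient.mk_surjective r
    rw [Algebra.smul_def, halg, ← map_mul, hg, hθ, hg, map_mul]
    rfl

theorem exists_addMonoidHom_quotient_of_socle {p : ℕ} (hp : 1 < p) {R S : Type*} [CommRing R]
    [CommRing S] [IsNoetherianRing R] [IsNoetherianRing S] [IsLocalRing R] [IsLocalRing S]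
    [ExpChar R p] [ExpChar S p] (hffR : IsFFinite R p) (hffS : IsFFinite S p) [Algebra R S]
    [Module.Flat R S] {I : Ideal R} {n : ℕ}
    (hI : maximalIdeal R ^ n ≤ I) (hIm : I ≤ maximalIdeal R) {e : ℕ} {c : R} {θ : R →+ R}
    (hθ : ∀ a x, θ (a ^ p ^ e * x) = a * θ x) (hc : θ c = 1) {zs : List S}
    (hz : RingTheory.Sequence.IsWeaklyRegular (S ⧸ (maximalIdeal R).map (algebraMap R S)) zs)
    (hzq : RingTheory.Sequence.IsWeaklyRegular (S ⧸ (maximalIdeal R).map (algebraMap R S))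
      (zs.map (iterateFrobenius S p e)))
    (hrad : maximalIdeal S ≤ ((maximalIdeal R).map (algebraMap R S) ⊔ Ideal.ofList zs).radical)
    {u : S} (hu : ∀ s ∉ (maximalIdeal R).map (algebraMap R S) ⊔ Ideal.ofList zs,
      ∃ b, u - b * s ∈ (maximalIdeal R).map (algebraMap R S) ⊔ Ideal.ofList zs)
    (huq : u ^ p ^ e ∉ (maximalIdeal R).map (algebraMap R S) ⊔
      Ideal.ofList (zs.map (iterateFrobenius S p e)))
    {J : Ideal S} (hJ : J = I.map (algebraMap R S) ⊔ Ideal.ofList zs) :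
    ∃ φ : S →+ S ⧸ J, (∀ a x, φ (a ^ p ^ e * x) = Ideal.Quotient.mk J a * φ x) ∧
      φ (algebraMap R S c) = 1 := by
  have hq : 0 < p ^ e := pow_pos (by lia) e
  set K := (maximalIdeal R).map (algebraMap R S) with hK
  set I₁ := I.map (iterateFrobenius R p e) with hI₁
  have hIm₁ : I₁ ≤ maximalIdeal R := Ideal.map_le_iff_le_comap.2 fun a ha =>
    Ideal.pow_mem_of_mem _ (hIm ha) _ hq
  obtain ⟨n₁, hn₁⟩ : ∃ n₁, maximalIdeal R ^ n₁ ≤ I₁ := by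
    refine Ideal.exists_pow_le_of_le_radical_of_fg (fun x hx => ⟨n * p ^ e, ?_⟩)
      (IsNoetherian.noetherian _)
    rw [pow_mul, ← iterateFrobenius_def]
    exact Ideal.mem_map_of_mem _ (hI (Ideal.pow_mem_pow hx n))
  set J₁ := I₁.map (algebraMap R S) ⊔ Ideal.ofList (zs.map (iterateFrobenius S p e)) with hJ₁
  have hcomm : ∀ r, iterateFrobenius S p e (algebraMap R S r) =
      algebraMap R S (iterateFrobenius R p e r) := fun r => by
    simp only [iterateFrobenius_def, map_pow]
  have hJJ : J.map (iterateFrobenius S p e) = J₁ := by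
    rw [hJ, hJ₁, Ideal.map_sup, Ideal.map_ofList, hI₁, Ideal.map_map, Ideal.map_map]
    congr 2
    exact RingHom.ext hcomm
  have : Nontrivial (R ⧸ I) := Ideal.Quotient.nontrivial_iff.2 fun h =>
    (maximalIdeal.isMaximal R).ne_top (top_le_iff.1 (h ▸ hIm))
  have : Nontrivial (R ⧸ I₁) := Ideal.Quotient.nontrivial_iff.2 fun h =>
    (maximalIdeal.isMaximal R).ne_top (top_le_iff.1 (h ▸ hIm₁))
  have : IsLocalRing (R ⧸ I) := .of_surjective' _ Ideal.Quotient.mk_surjective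
  have : IsLocalRing (R ⧸ I₁) := .of_surjective' _ Ideal.Quotient.mk_surjective
  let _ : Algebra (R ⧸ I) (R ⧸ I₁) :=
    (Ideal.quotientMap I₁ (iterateFrobenius R p e) Ideal.le_comap_map).toAlgebra
  let _ : Algebra (R ⧸ I) (S ⧸ J) := (Ideal.quotientMap J (algebraMap R S)
    (Ideal.map_le_iff_le_comap.1 (hJ ▸ le_sup_left))).toAlgebra
  let _ : Algebra (R ⧸ I₁) (S ⧸ J₁) := (Ideal.quotientMap J₁ (algebraMap R S)
    (Ideal.map_le_iff_le_comap.1 le_sup_left)).toAlgebra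
  let _ : Algebra (S ⧸ J) (S ⧸ J₁) := (Ideal.quotientMap J₁ (iterateFrobenius S p e)
    (Ideal.map_le_iff_le_comap.1 hJJ.le)).toAlgebra
  let _ : Algebra (R ⧸ I) (S ⧸ J₁) :=
    ((algebraMap (R ⧸ I₁) (S ⧸ J₁)).comp (algebraMap (R ⧸ I) (R ⧸ I₁))).toAlgebra
  have : IsScalarTower (R ⧸ I) (R ⧸ I₁) (S ⧸ J₁) := .of_algebraMap_eq fun _ => rfl
  have : IsScalarTower (R ⧸ I) (S ⧸ J) (S ⧸ J₁) := .of_algebraMap_eq fun r => by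
    obtain ⟨r, rfl⟩ := Ideal.Quotient.mk_surjective r
    exact congrArg (Ideal.Quotient.mk J₁) (hcomm r).symm
  have halg : ∀ r : R, algebraMap (R ⧸ I) (S ⧸ J) (Ideal.Quotient.mk I r) =
    Ideal.Quotient.mk J (algebraMap R S r) := fun _ => rfl
  have halg₁ : ∀ r : R, algebraMap (R ⧸ I₁) (S ⧸ J₁) (Ideal.Quotient.mk I₁ r) =
    Ideal.Quotient.mk J₁ (algebraMap R S r) := fun _ => rfl
  have halgS : ∀ s : S, algebraMap (S ⧸ J) (S ⧸ J₁) (Ideal.Quotient.mk J s) =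
    Ideal.Quotient.mk J₁ (s ^ p ^ e) := fun _ => rfl
  have := Module.Flat.quotient_sup_ofList hI hIm hz hJ halg
  have := Module.Flat.quotient_sup_ofList hn₁ hIm₁ hzq hJ₁ halg₁
  obtain ⟨N, hN⟩ : ∃ N, maximalIdeal S ^ N ≤ J := by
    refine Ideal.exists_pow_le_of_le_radical_of_fg (hrad.trans ?_) (IsNoetherian.noetherian _)
    rw [Ideal.radical_le_radical_iff, hJ]
    refine sup_le (Ideal.map_le_iff_le_comap.2 fun x hx => ⟨n, ?_⟩)
      (le_sup_right.trans Ideal.le_radical)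
    rw [← map_pow]
    exact Ideal.mem_sup_left (Ideal.mem_map_of_mem _ (hI (Ideal.pow_mem_pow hx n)))
  obtain ⟨_, _⟩ := hffR.exists_finiteDimensional_quotient hp hI
  obtain ⟨_, _⟩ := hffS.exists_finiteDimensional_quotient hp hN
  obtain ⟨E, _, _, ε, l, v, hε0, hmε, hsoc, hv⟩ :=
    exists_faithful_module_with_simple_socle (ResidueField R) (R ⧸ I)
  obtain ⟨θ', hθ'⟩ := exists_linearMap_quotient_map (F := iterateFrobenius R p e) hθ (I := I)
    fun _ => rfl
  have hKJ : K ⊔ J = K ⊔ Ideal.ofList zs := by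
    rw [hJ, ← sup_assoc, sup_eq_left.2 (Ideal.map_mono (f := algebraMap R S) hIm)]
  have hKJ₁ : K ⊔ J₁ = K ⊔ Ideal.ofList (zs.map (iterateFrobenius S p e)) := by
    rw [hJ₁, ← sup_assoc, sup_eq_left.2 (Ideal.map_mono (f := algebraMap R S) hIm₁)]
  have hnil : IsNilpotent (maximalIdeal (R ⧸ I)) := ⟨n, by
    rw [← map_maximalIdeal_of_surjective _ (Ideal.Quotient.mk_surjective (I := I)), ← Ideal.map_pow,
      Ideal.zero_eq_bot, Ideal.map_eq_bot_iff_le_ker,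
      Ideal.mk_ker]
    exact hI⟩
  obtain ⟨φ, hφ⟩ := exists_linearMap_eq_one_of_flat_of_socle (k := ResidueField S)
    (S₁ := S ⧸ J₁) (IsNoetherian.noetherian (maximalIdeal (R ⧸ I))) hnil hε0 hmε hsoc hv
    (c := Ideal.Quotient.mk I₁ c) θ' (by rw [hθ', hc, map_one]) (u := Ideal.Quotient.mk J u)
    (fun s hs => by
      obtain ⟨s, rfl⟩ := Ideal.Quotient.mk_surjective s
      rw [← map_maximalIdeal_of_surjective _ (Ideal.Quotient.mk_surjective (I := I)),
        Ideal.mk_mem_map_map_mk_iff halg, hKJ] at hs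
      obtain ⟨b, hb⟩ := hu s hs
      refine ⟨Ideal.Quotient.mk J b, ?_⟩
      rwa [← map_mul, ← map_sub,
        ← map_maximalIdeal_of_surjective _ (Ideal.Quotient.mk_surjective (I := I)),
        Ideal.mk_mem_map_map_mk_iff halg, hKJ])
    (by rwa [halgS, ← map_maximalIdeal_of_surjective _ (Ideal.Quotient.mk_surjective (I := I₁)),
      Ideal.mk_mem_map_map_mk_iff halg₁, hKJ₁])
  refine ⟨φ.toAddMonoidHom.comp (Ideal.Quotient.mk J₁).toAddMonoidHom, fun a x => ?_, hφ⟩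
  change φ (Ideal.Quotient.mk J₁ (a ^ p ^ e * x)) = _ * φ (Ideal.Quotient.mk J₁ x)
  rw [map_mul, ← halgS, ← Algebra.smul_def, map_smul, smul_eq_mul]

theorem RingHom.Finite.exists_addMonoidHom_eq_one {A B : Type*} [CommRing A] [CommRing B]
    [IsNoetherianRing A] [IsLocalRing A] {f : A →+* B} (hf : f.Finite) {c : B}
    (h : ∀ n : ℕ, ∃ φ : B →+ A ⧸ maximalIdeal A ^ n,
      (∀ a x, φ (f a * x) = Ideal.Quotient.mk _ a * φ x) ∧ φ c = 1) :
    ∃ θ : B →+ A, (∀ a x, θ (f a * x) = a * θ x) ∧ θ c = 1 := by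
  let _ := f.toAlgebra
  have : Module.Finite A B := hf
  obtain ⟨φ, hφ⟩ := exists_linearMap_eq_one_of_forall_quotient (S := A) (x := c) fun n => by
    obtain ⟨φ, hφ, hc⟩ := h n
    exact ⟨{ φ with map_smul' := hφ }, hc⟩
  exact ⟨φ.toAddMonoidHom, fun a x => φ.map_smul a x, hφ⟩

theorem IsSystemOfParameters.pow {A : Type*} [CommRing A] [IsLocalRing A] {d : ℕ} {x : Fin d → A}
    (hx : IsSystemOfParameters A x) (t : ℕ) :
    IsSystemOfParameters A fun i => x i ^ (t + 1) := by
  refine ⟨hx.1, fun i => Ideal.pow_mem_of_mem _ (hx.2.1 i) _ t.succ_pos, hx.2.2.trans ?_⟩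
  rw [Ideal.radical_le_radical_iff, Ideal.span_le]
  rintro _ ⟨i, rfl⟩
  exact ⟨t + 1, Ideal.subset_span ⟨i, rfl⟩⟩

theorem IsSystemOfParameters.isParameterIdeal {A : Type*} [CommRing A] [IsLocalRing A] {d : ℕ}
    {x : Fin d → A} (hx : IsSystemOfParameters A x) :
    (Ideal.span (Set.range x)).IsParameterIdeal :=
  ⟨d, d, le_rfl, x, hx, rfl⟩

theorem Ideal.ofList_ofFn {A : Type*} [CommRing A] {d : ℕ} (x : Fin d → A) :
    Ideal.ofList (List.ofFn x) = Ideal.span (Set.range x) := by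
  rw [Ideal.ofList]
  congr 1
  ext a
  simp [List.mem_ofFn]

theorem Ideal.mk_mem_ofList_map_iff {A : Type*} [CommRing A] {K : Ideal A} {l : List A} {s : A} :
    Ideal.Quotient.mk K s ∈ Ideal.ofList (l.map (Ideal.Quotient.mk K)) ↔
      s ∈ K ⊔ Ideal.ofList l := by
  rw [← Ideal.map_ofList, ← Ideal.mem_comap,
    Ideal.comap_map_of_surjective' _ Ideal.Quotient.mk_surjective, Ideal.mk_ker, sup_comm]

/-- If `R` splits off `c^{1/q}`, then so does every flat local extension `S` of `R` whose closed
fiber `S ⧸ K` is Gorenstein and F-injective, with the same `q`. -/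
theorem FrobSplits.of_isFInjective_closedFiber {p : ℕ} [Fact p.Prime] {R S : Type*} [CommRing R]
    [CommRing S] [IsNoetherianRing R] [IsNoetherianRing S] [IsLocalRing R] [IsLocalRing S]
    [CharP R p] [CharP S p] (hffR : IsFFinite R p) (hffS : IsFFinite S p) [Algebra R S]
    [Module.Flat R S] [IsLocalHom (algebraMap R S)] {K : Ideal S}
    (hK : (maximalIdeal R).map (algebraMap R S) = K) [IsLocalRing (S ⧸ K)]
    (hGor : IsGorensteinLocalRing (S ⧸ K)) (hFinj : IsFInjective (S ⧸ K) p) {c : R} {e : ℕ}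
    (hsplit : FrobSplits p c e) : FrobSplits p (algebraMap R S c) e := by
  obtain ⟨θ, hθ, hc⟩ := hsplit
  obtain ⟨d, x, hsop, hreg, hirr⟩ := hGor
  have hp : p.Prime := Fact.out
  have : ExpChar R p := .prime hp
  have : ExpChar S p := .prime hp
  choose z hz using fun i => Ideal.Quotient.mk_surjective (I := K) (x i)
  have hlist : ∀ t : ℕ, ((List.ofFn z).map (· ^ t)).map (Ideal.Quotient.mk K) =
      List.ofFn fun i => x i ^ t := fun t => by
    rw [List.map_ofFn, List.map_ofFn]
    exact congrArg List.ofFn (funext fun i => by simp [← hz])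
  have hlist₁ : (List.ofFn z).map (Ideal.Quotient.mk K) = List.ofFn x := by
    rw [List.map_ofFn]
    exact congrArg List.ofFn (funext hz)
  have hloc : IsLocalHom (Ideal.Quotient.mk K) := .of_surjective _ Ideal.Quotient.mk_surjective
  have hmem : ∀ y ∈ [] ++ List.ofFn z, y ∈ maximalIdeal S := by
    intro y hy
    obtain ⟨i, rfl⟩ := List.mem_ofFn.1 hy
    rw [← maximalIdeal_comap (Ideal.Quotient.mk K), Ideal.mem_comap, hz]
    exact hsop.2.1 i
  have hregS : RingTheory.Sequence.IsWeaklyRegular (S ⧸ K) ([] ++ List.ofFn z) := by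
    rw [List.nil_append, ← RingTheory.Sequence.isWeaklyRegular_map_algebraMap_iff (S ⧸ K) (S ⧸ K)]
    have := hreg.toIsWeaklyRegular
    rwa [← hlist₁] at this
  have hsocS : ∃ u ∉ K ⊔ Ideal.ofList ([] ++ List.ofFn z),
      ∀ s ∉ K ⊔ Ideal.ofList ([] ++ List.ofFn z),
        ∃ b, u - b * s ∈ K ⊔ Ideal.ofList ([] ++ List.ofFn z) := by
    obtain ⟨u, hu, hu'⟩ := hirr.exists_socle hsop.2.2
    obtain ⟨u, rfl⟩ := Ideal.Quotient.mk_surjective u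
    have key (s : S) : s ∈ K ⊔ Ideal.ofList ([] ++ List.ofFn z) ↔
        Ideal.Quotient.mk K s ∈ Ideal.span (Set.range x) := by
      rw [List.nil_append, ← Ideal.mk_mem_ofList_map_iff, hlist₁, Ideal.ofList_ofFn]
    simp only [key]
    refine ⟨u, hu, fun s hs => ?_⟩
    obtain ⟨b, hb⟩ := hu' _ hs
    obtain ⟨b, rfl⟩ := Ideal.Quotient.mk_surjective b
    exact ⟨b, by rwa [map_sub, map_mul]⟩
  have hpow := fun t => Ideal.isWeaklyRegular_map_pow_and_exists_socle t _ _ hmem hregS hsocS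
  simp only [List.nil_append] at hpow
  refine (hffS.finite_iterateFrobenius e).exists_addMonoidHom_eq_one fun n => ?_
  obtain ⟨hreg_n, u, hu, hu'⟩ := hpow n
  have hq : 0 < p ^ e := pow_pos hp.pos e
  have hmap : ((List.ofFn z).map (· ^ (n + 1))).map (iterateFrobenius S p e) =
      (List.ofFn z).map (· ^ ((n + 1) * p ^ e)) := by
    rw [List.map_map]
    exact List.map_congr_left fun y _ => (pow_mul y _ _).symm
  have hregq : RingTheory.Sequence.IsWeaklyRegular (S ⧸ K)
      (((List.ofFn z).map (· ^ (n + 1))).map (iterateFrobenius S p e)) := by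
    have := (hpow ((n + 1) * p ^ e - 1)).1
    rwa [Nat.sub_add_cancel (Nat.mul_pos n.succ_pos hq), ← hmap] at this
  have hsop_n := hsop.pow n
  have hrad : maximalIdeal S ≤ (K ⊔ Ideal.ofList ((List.ofFn z).map (· ^ (n + 1)))).radical := by
    intro y hy
    rw [← maximalIdeal_comap (Ideal.Quotient.mk K), Ideal.mem_comap] at hy
    obtain ⟨k, hk⟩ := hsop_n.2.2 hy
    refine ⟨k, ?_⟩
    rwa [← Ideal.mk_mem_ofList_map_iff, hlist, Ideal.ofList_ofFn, map_pow]
  have huq : u ^ p ^ e ∉ K ⊔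
      Ideal.ofList (((List.ofFn z).map (· ^ (n + 1))).map (iterateFrobenius S p e)) := by
    intro h
    refine hu ?_
    rw [← Ideal.mk_mem_ofList_map_iff, hlist, Ideal.ofList_ofFn]
    refine hFinj _ hsop_n.isParameterIdeal _ ⟨e, ?_⟩
    rw [hmap, ← Ideal.mk_mem_ofList_map_iff, hlist, Ideal.ofList_ofFn, map_pow] at h
    refine Ideal.span_le.2 ?_ h
    rintro _ ⟨i, rfl⟩
    exact Ideal.subset_span ⟨_, Ideal.subset_span ⟨i, rfl⟩, (pow_mul _ _ _).symm⟩
  subst hK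
  obtain ⟨φ, hφ, hφc⟩ := exists_addMonoidHom_quotient_of_socle hp.one_lt hffR hffS le_rfl
    (Ideal.pow_le_self n.succ_ne_zero) hθ hc hreg_n hregq hrad hu' huq rfl
  have hle : (maximalIdeal R ^ (n + 1)).map (algebraMap R S) ⊔
      Ideal.ofList ((List.ofFn z).map (· ^ (n + 1))) ≤ maximalIdeal S ^ n := by
    refine sup_le ?_ (Ideal.span_le.2 fun y hy => ?_)
    · rw [Ideal.map_pow]
      exact (Ideal.pow_right_mono (map_maximalIdeal_le (algebraMap R S)) _).trans
        (Ideal.pow_le_pow_right n.le_succ)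
    · obtain ⟨y, hyz, rfl⟩ := List.mem_map.1 hy
      exact Ideal.pow_le_pow_right n.le_succ (Ideal.pow_mem_pow (hmem y hyz) _)
  refine ⟨(Ideal.Quotient.factor hle).toAddMonoidHom.comp φ, fun a y => ?_, ?_⟩
  · change Ideal.Quotient.factor hle (φ (a ^ p ^ e * y)) = _ * Ideal.Quotient.factor hle (φ y)
    rw [hφ, map_mul, Ideal.Quotient.factor_mk]
  · change Ideal.Quotient.factor hle (φ _) = 1
    rw [hφc, map_one]

end

/-- **Proposition 3.3(1)** (Aberbach). Let `(R,m,K) → (S,n,L)` be a flat local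
homomorphism of F-finite reduced Noetherian local rings of prime characteristic `p`
with Gorenstein closed fiber, and let `c ∈ R`. If `R c^{1/q} ⊆ R^{1/q}` splits over `R`
for some `q` and `S/mS` is F-injective, then `S c^{1/q} ⊆ S^{1/q}` splits over `S`
for some `q`. -/
theorem frobSplits_extension_of_fInjective_fiber
    (p : ℕ) [Fact p.Prime]
    (R S : Type*) [CommRing R] [CommRing S]
    [IsNoetherianRing R] [IsNoetherianRing S]
    [IsLocalRing R] [IsLocalRing S] [CharP R p] [CharP S p]
    [IsReduced R] [IsReduced S] (hffR : IsFFinite R p) (hffS : IsFFinite S p)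
    [Algebra R S] [Module.Flat R S] [IsLocalHom (algebraMap R S)]
    [IsLocalRing (S ⧸ Ideal.map (algebraMap R S) (IsLocalRing.maximalIdeal R))]
    (hGor : IsGorensteinLocalRing (S ⧸ Ideal.map (algebraMap R S) (IsLocalRing.maximalIdeal R)))
    (c : R) (hsplit : ∃ e : ℕ, FrobSplits p c e)
    (hFinj : IsFInjective (S ⧸ Ideal.map (algebraMap R S) (IsLocalRing.maximalIdeal R)) p) :
    ∃ e : ℕ, FrobSplits p (algebraMap R S c) e := by
  obtain ⟨e, he⟩ := hsplit
  exact ⟨e, he.of_isFInjective_closedFiber hffR hffS rfl hGor hFinj⟩
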